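/- Let ν > −1 and let μ_ν be the measure on (0,1) with density x^{2ν+1} with respect to Lebesgue measure. Let j ≥ 1 be an integer and let I = (x_I − r_I, x_I + r_I) be an interval with I ⊂ ℐ_j^*. Let a : (0,1) → ℝ be measurable with supp a ⊂ I, ‖a‖_∞ ≤ μ_ν(I)^{−1}, and ∫_I a dμ_ν = 0. Let P : (0,∞)×(0,1)×(0,1) → ℝ be such that y ↦ P_t(x,y) is differentiable for each x, t, and suppose there are constants A, c > 0 such that: (K1) ∫₀¹ |P_t(x,y)| dμ_ν(y) ≤ A for all x ∈ (0,1) and t > 0; and (K2) |∂_y P_t(x,y)| ≤ A (xy)^{−(ν+1/2)} t^{−1} e^{−(x−y)²/(ct)} for all x, y ∈ (0,1), t > 0. Then there exists a constant C depending only on A, c, ν (and not on j, I, a) such that ∫₀¹ sup_{t>0} |∫₀¹ P_t(x,y) a(y) dμ_ν(y)| dμ_ν(x) ≤ C. -/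

import Mathlib

open MeasureTheory

/-- The measure on `(0,1)` with density `x^{2ν+1}` with respect to Lebesgue measure. -/
noncomputable def muBessel01 (ν : ℝ) : Measure ℝ :=
  (volume.restrict (Set.Ioo 0 1)).withDensity (fun x => ENNReal.ofReal (x ^ (2*ν+1)))

/-- `ℐ_j = (1-2^{-j}, 1-2^{-j-1}]` for `j ∈ ℕ`. -/
noncomputable def Iset (j : ℕ) : Set ℝ :=
  Set.Ioc (1 - (2:ℝ)^(-(j:ℤ))) (1 - (2:ℝ)^(-(j:ℤ)-1))

/-- Centre of `ℐ_j`. -/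
noncomputable def Icen (j : ℕ) : ℝ := 1 - 3 * (2:ℝ)^(-(j:ℤ)-2)

/-- Half-length of `ℐ_j`. -/
noncomputable def Irad (j : ℕ) : ℝ := (2:ℝ)^(-(j:ℤ)-2)

/-- `ℐ_j^*`: the interval with the same centre as `ℐ_j` and one twentieth of its length. -/
noncomputable def Istar (j : ℕ) : Set ℝ :=
  Set.Ioo (Icen j - Irad j / 20) (Icen j + Irad j / 20)


lemma bes_integral (ν : ℝ) (f : ℝ → ℝ) :
    ∫ x, f x ∂(muBessel01 ν) = ∫ x in Set.Ioo (0:ℝ) 1, x ^ (2*ν+1) * f x := by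
  unfold muBessel01
  rw [integral_withDensity_eq_integral_toReal_smul (by fun_prop) (by simp)]
  apply setIntegral_congr_fun measurableSet_Ioo
  intro x hx
  simp only [smul_eq_mul]
  rw [ENNReal.toReal_ofReal (Real.rpow_nonneg hx.1.le _)]

lemma bes_integrable (ν : ℝ) (f : ℝ → ℝ) :
    Integrable f (muBessel01 ν) ↔ IntegrableOn (fun x => x ^ (2*ν+1) * f x) (Set.Ioo (0:ℝ) 1) := by
  unfold muBessel01
  rw [integrable_withDensity_iff_integrable_smul' (by fun_prop) (by simp)]
  apply integrableOn_congr_fun _ measurableSet_Ioo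
  intro x hx
  simp only [smul_eq_mul]
  rw [ENNReal.toReal_ofReal (Real.rpow_nonneg hx.1.le _)]

lemma bes_ac (ν : ℝ) : muBessel01 ν ≪ volume.restrict (Set.Ioo (0:ℝ) 1) :=
  withDensity_absolutelyContinuous _ _

lemma bes_ae (ν : ℝ) : ∀ᵐ x ∂(muBessel01 ν), x ∈ Set.Ioo (0:ℝ) 1 :=
  (bes_ac ν).ae_le (ae_restrict_mem measurableSet_Ioo)

lemma bes_rpow (p : ℝ) (hp : -1 < p) :
    IntegrableOn (fun x : ℝ => x ^ p) (Set.Ioo (0:ℝ) 1) := by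
  have h := (intervalIntegral.intervalIntegrable_rpow' (a := 0) (b := 1) hp)
  rw [intervalIntegrable_iff_integrableOn_Ioo_of_le zero_le_one] at h
  exact h

lemma bes_fin (ν : ℝ) (hν : -1 < ν) : IsFiniteMeasure (muBessel01 ν) := by
  have h : Integrable (fun _ : ℝ => (1:ℝ)) (muBessel01 ν) := by
    rw [bes_integrable]
    simpa using bes_rpow (2*ν+1) (by linarith)
  simpa [integrable_const_iff] using h

lemma bes_kernel (ν K : ℝ) (hν : -1 < ν) (hK : 0 ≤ K) (f f' : ℝ → ℝ)
    (hf : ∀ y ∈ Set.Ioo (0:ℝ) 1, HasDerivAt f (f' y) y)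
    (hb : ∀ y ∈ Set.Ioo (0:ℝ) 1, |f' y| ≤ K * y ^ (-(ν+1/2))) :
    Integrable f (muBessel01 ν) := by
  have := bes_fin ν hν
  have hg : Integrable (fun y => |f (1/2)| + K * (y ^ (-(ν+1/2)) + (1/2:ℝ)^ (-(ν+1/2))))
      (muBessel01 ν) := by
    refine (integrable_const _).add (Integrable.const_mul (Integrable.add ?_ (integrable_const _)) _)
    rw [bes_integrable]
    refine (bes_rpow (ν+1/2) (by linarith)).congr_fun ?_ measurableSet_Ioo
    intro x hx
    simp only
    rw [← Real.rpow_add hx.1]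
    congr 1; ring
  refine hg.mono' ?_ ?_
  · refine AEStronglyMeasurable.mono_ac (bes_ac ν) ?_
    exact ContinuousOn.aestronglyMeasurable
      (fun y hy => (hf y hy).continuousAt.continuousWithinAt) measurableSet_Ioo
  · filter_upwards [bes_ae ν] with y hy
    have hsub : Set.uIcc y (1/2) ⊆ Set.Ioo (0:ℝ) 1 := by
      intro z hz
      rw [Set.mem_uIcc] at hz
      obtain ⟨h1, h2⟩ := hy
      constructor <;> rcases hz with hz | hz <;> linarith [hz.1, hz.2]
    have hmv := Convex.norm_image_sub_le_of_norm_hasDerivWithin_le (f := f) (f' := f')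
      (s := Set.uIcc y (1/2)) (x := 1/2) (y := y)
      (C := K * (y ^ (-(ν+1/2)) + (1/2:ℝ)^ (-(ν+1/2))))
      (fun z hz => (hf z (hsub hz)).hasDerivWithinAt) ?_ (convex_uIcc _ _)
      Set.right_mem_uIcc Set.left_mem_uIcc
    · rw [Real.norm_eq_abs, Real.norm_eq_abs] at hmv
      have h1 : |y - 1/2| ≤ 1 := by
        rw [abs_le]; constructor <;> linarith [hy.1, hy.2]
      have h0 : 0 ≤ K * (y ^ (-(ν+1/2)) + (1/2:ℝ)^ (-(ν+1/2))) := by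
        have := Real.rpow_nonneg hy.1.le (-(ν+1/2))
        positivity
      have h2 := mul_le_mul_of_nonneg_left h1 h0
      have h3 := abs_sub_abs_le_abs_sub (f y) (f (1/2))
      rw [Real.norm_eq_abs]
      linarith
    · intro z hz
      rw [Real.norm_eq_abs]
      refine (hb z (hsub hz)).trans (mul_le_mul_of_nonneg_left ?_ hK)
      have hz0 := (hsub hz).1
      have e1 := Real.rpow_nonneg hy.1.le (-(ν+1/2))
      have e2 := Real.rpow_nonneg (x := (1/2:ℝ)) (by norm_num) (-(ν+1/2))
      rw [Set.mem_uIcc] at hz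
      rcases le_total 0 (-(ν+1/2)) with hp | hp
      · rcases hz with hz | hz
        · linarith [Real.rpow_le_rpow hz0.le hz.2 hp]
        · linarith [Real.rpow_le_rpow hz0.le hz.2 hp]
      · rcases hz with hz | hz
        · linarith [Real.rpow_le_rpow_of_nonpos hy.1 hz.1 hp]
        · linarith [Real.rpow_le_rpow_of_nonpos (by norm_num) hz.1 hp]

lemma bes_pow_le (p s y : ℝ) (hp : |p| ≤ |s|) (h1 : 1/4 ≤ y) (h2 : y ≤ 1) :
    y ^ p ≤ (4:ℝ) ^ |s| := by
  have h3 : y ^ p ≤ y ^ (-|s|) :=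
    Real.rpow_le_rpow_of_exponent_ge (by linarith) h2 (by linarith [neg_abs_le p])
  have h4 : y ^ (-|s|) ≤ (1/4:ℝ) ^ (-|s|) :=
    Real.rpow_le_rpow_of_nonpos (by norm_num) h1 (by linarith [abs_nonneg s])
  have h5 : (1/4:ℝ) ^ (-|s|) = 4 ^ |s| := by
    rw [one_div, Real.inv_rpow (by norm_num), Real.rpow_neg (by norm_num), inv_inv]
  linarith

lemma bes_exp (k : ℝ) (hk : 0 < k) (t : ℝ) (ht : 0 < t) :
    t⁻¹ * Real.exp (-(k / t)) ≤ k⁻¹ := by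
  have h := Real.add_one_le_exp (k/t)
  have h0 : 0 < k / t := by positivity
  rw [Real.exp_neg, ← mul_inv]
  apply inv_anti₀ hk
  calc k = t * (k/t) := by field_simp
    _ ≤ t * Real.exp (k/t) := by gcongr; linarith

lemma bes_poisson (x0 r : ℝ) (hr : 0 < r) :
    Integrable (fun x : ℝ => r / ((x - x0)^2 + r^2)) ∧
    ∫ x : ℝ, r / ((x - x0)^2 + r^2) = Real.pi := by
  have e : (fun x : ℝ => r / ((x - x0)^2 + r^2))
      = fun x => (fun u : ℝ => r⁻¹ * (fun w : ℝ => (1 + w^2)⁻¹) (u / r)) (x - x0) := by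
    funext x
    simp only
    field_simp
    ring
  constructor
  · rw [e]
    exact ((integrable_inv_one_add_sq.comp_div hr.ne').const_mul _).comp_sub_right x0
  · rw [e, integral_sub_right_eq_self (fun u : ℝ => r⁻¹ * (fun w : ℝ => (1 + w^2)⁻¹) (u / r)),
      integral_const_mul, Measure.integral_comp_div (fun w : ℝ => (1 + w^2)⁻¹) r, integral_univ_inv_one_add_sq, abs_of_pos hr]
    simp only [smul_eq_mul]
    field_simp

lemma bes_measure (ν x0 r : ℝ) (hν : -1 < ν) (hr : 0 < r) (h1 : 1/4 ≤ x0 - r) (h2 : x0 + r ≤ 1) :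
    2 * r * ((4:ℝ) ^ |2*ν+1|)⁻¹ ≤ ((muBessel01 ν) (Set.Ioo (x0 - r) (x0 + r))).toReal := by
  have := bes_fin ν hν
  have hB : 0 < (4:ℝ) ^ |2*ν+1| := by positivity
  have e : ((muBessel01 ν) (Set.Ioo (x0 - r) (x0 + r))).toReal
      = ∫ x in Set.Ioo (x0 - r) (x0 + r), x ^ (2*ν+1) := by
    have := integral_indicator_one (μ := muBessel01 ν) (measurableSet_Ioo (a := x0 - r) (b := x0 + r))
    rw [← measureReal_def, ← this, bes_integral]
    have hs : Set.Ioo (x0 - r) (x0 + r) ⊆ Set.Ioo 0 1 := by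
      intro z hz; exact ⟨by linarith [hz.1], by linarith [hz.2]⟩
    rw [← Set.inter_eq_right.2 hs, ← setIntegral_indicator measurableSet_Ioo, Set.inter_eq_right.2 hs]
    congr 1
    funext x
    by_cases hx : x ∈ Set.Ioo (x0 - r) (x0 + r) <;> simp [hx]
  rw [e]
  have hc : ∫ x in Set.Ioo (x0 - r) (x0 + r), ((4:ℝ) ^ |2*ν+1|)⁻¹ = 2 * r * ((4:ℝ) ^ |2*ν+1|)⁻¹ := by
    rw [setIntegral_const, measureReal_def, Real.volume_Ioo, ENNReal.toReal_ofReal (by linarith), smul_eq_mul]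
    ring
  rw [← hc]
  apply setIntegral_mono_on (by simp) _ measurableSet_Ioo
  · intro x hx
    have hx0 : 0 < x := by linarith [hx.1]
    have := bes_pow_le (-(2*ν+1)) (2*ν+1) x (by rw [abs_neg]) (by linarith [hx.1]) (by linarith [hx.2])
    rw [Real.rpow_neg hx0.le] at this
    rw [inv_le_comm₀ hB (Real.rpow_pos_of_pos hx0 _)]
    exact this
  · exact (bes_rpow (2*ν+1) (by linarith)).mono_set
      (fun z hz => ⟨by linarith [hz.1], by linarith [hz.2]⟩)

set_option maxHeartbeats 1000000 in
/-- Uniform `L¹(dμ_ν)` bound for the radial maximal function of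
cancellative atoms supported in `ℐ_j^*` (`j ≥ 1`) under the kernel hypotheses
(K1) (uniform `L¹(dμ_ν)` bound) and (K2) (derivative bound in `y`). -/
theorem bessel_dmu_typeA_atom_maximal (ν A c : ℝ)
    (hν : -1 < ν) (hA : 0 < A) (hc : 0 < c) :
    ∃ C : ℝ, 0 < C ∧
    ∀ j : ℕ, 1 ≤ j →
    ∀ xI rI : ℝ, 0 < rI → Set.Ioo (xI - rI) (xI + rI) ⊆ Istar j →
    ∀ a : ℝ → ℝ, Measurable a →
      Function.support a ⊆ Set.Ioo (xI - rI) (xI + rI) →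
      (∀ y, |a y| ≤ (((muBessel01 ν) (Set.Ioo (xI - rI) (xI + rI))).toReal)⁻¹) →
      (∫ y in Set.Ioo (xI - rI) (xI + rI), a y ∂(muBessel01 ν)) = 0 →
    ∀ P Py : ℝ → ℝ → ℝ → ℝ,
      (∀ t : ℝ, 0 < t → ∀ x ∈ Set.Ioo (0:ℝ) 1, ∀ y ∈ Set.Ioo (0:ℝ) 1,
        HasDerivAt (fun z => P t x z) (Py t x y) y) →
      (∀ x ∈ Set.Ioo (0:ℝ) 1, ∀ t : ℝ, 0 < t →
        (∫ y, |P t x y| ∂(muBessel01 ν)) ≤ A) →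
      (∀ x ∈ Set.Ioo (0:ℝ) 1, ∀ y ∈ Set.Ioo (0:ℝ) 1, ∀ t : ℝ, 0 < t →
        |Py t x y| ≤ A * (x*y) ^ (-(ν+1/2)) * t⁻¹ * Real.exp (-(x-y)^2 / (c*t))) →
      ∫ x, (⨆ (t : ℝ) (_ : 0 < t),
          |∫ y, P t x y * a y ∂(muBessel01 ν)|) ∂(muBessel01 ν) ≤ C := by
  set B : ℝ := (4:ℝ) ^ |2*ν+1| with hBdef
  have hB : 0 < B := by positivity
  set K : ℝ := 5 * A * B^2 * (1 + c) with hKdef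
  set K3 : ℝ := 64 * A * B * c with hK3def
  have hK : 0 < K := by positivity
  have hK3 : 0 < K3 := by positivity
  have hJ0 : 0 ≤ ∫ x in Set.Ioo (0:ℝ) 1, x ^ (ν+1/2) :=
    setIntegral_nonneg measurableSet_Ioo (fun x hx => Real.rpow_nonneg hx.1.le _)
  refine ⟨K * Real.pi + K3 * ∫ x in Set.Ioo (0:ℝ) 1, x ^ (ν+1/2), by positivity, ?_⟩
  intro j hj x0 r hr hI a ham hsupp hab ha0 P Py hder hK1 hK2
  have := bes_fin ν hν
  have hw0 : 0 < Irad j := by unfold Irad; positivity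
  have hw1 : Irad j ≤ 1/8 := by
    unfold Irad
    calc (2:ℝ)^(-(j:ℤ)-2) ≤ (2:ℝ)^(-3:ℤ) := by
          apply zpow_le_zpow_right₀ (by norm_num); omega
      _ = 1/8 := by norm_num
  have hcen : Icen j = 1 - 3 * Irad j := rfl
  unfold Istar at hI
  rw [Set.Ioo_subset_Ioo_iff (by linarith), hcen] at hI
  obtain ⟨hI1, hI2⟩ := hI
  have hr1 : r ≤ 1/100 := by linarith
  have hx0 : 3/5 ≤ x0 - r := by linarith
  have hx1 : x0 + r < 1 := by linarith
  have hmeas := bes_measure ν x0 r hν hr (by linarith) hx1.le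
  set m : ℝ := ((muBessel01 ν) (Set.Ioo (x0 - r) (x0 + r))).toReal with hm
  have hm0 : 0 < m := lt_of_lt_of_le (by positivity) hmeas
  have hminv : m⁻¹ ≤ B / (2 * r) := by
    calc m⁻¹ ≤ (2 * r * B⁻¹)⁻¹ := inv_anti₀ (by positivity) hmeas
      _ = B / (2*r) := by field_simp
  have hIsub : Set.Ioo (x0 - r) (x0 + r) ⊆ Set.Ioo 0 1 := by
    intro z hz; exact ⟨by linarith [hz.1], by linarith [hz.2]⟩
  have hint : ∀ x ∈ Set.Ioo (0:ℝ) 1, ∀ t : ℝ, 0 < t →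
      Integrable (fun y => P t x y) (muBessel01 ν) := by
    intro x hx t ht
    have hxq := Real.rpow_nonneg hx.1.le (-(ν+1/2))
    refine bes_kernel ν (A * x ^ (-(ν+1/2)) * t⁻¹) hν (by positivity) _ (Py t x) (hder t ht x hx) ?_
    intro y hy
    have hyq := Real.rpow_nonneg hy.1.le (-(ν+1/2))
    refine (hK2 x hx y hy t ht).trans ?_
    rw [Real.mul_rpow hx.1.le hy.1.le]
    have he : Real.exp (-(x-y)^2 / (c*t)) ≤ 1 := by
      rw [Real.exp_le_one_iff]
      apply div_nonpos_of_nonpos_of_nonneg _ (by positivity)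
      linarith [sq_nonneg (x-y)]
    calc A * (x ^ (-(ν+1/2)) * y ^ (-(ν+1/2))) * t⁻¹ * Real.exp (-(x-y)^2 / (c*t))
        ≤ A * (x ^ (-(ν+1/2)) * y ^ (-(ν+1/2))) * t⁻¹ * 1 := by gcongr
      _ = _ := by ring
  have haint : Integrable a (muBessel01 ν) :=
    Integrable.of_bound ham.aestronglyMeasurable m⁻¹ (Filter.Eventually.of_forall hab)
  have haz : ∀ y, y ∉ Set.Ioo (x0 - r) (x0 + r) → a y = 0 := by
    intro y hy
    by_contra h
    exact hy (hsupp h)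
  have ha0' : ∫ y, a y ∂(muBessel01 ν) = 0 := by
    rw [← ha0, setIntegral_eq_integral_of_forall_compl_eq_zero haz]
  have haL1 : ∫ y, |a y| ∂(muBessel01 ν) ≤ 1 := by
    rw [← setIntegral_eq_integral_of_forall_compl_eq_zero (s := Set.Ioo (x0 - r) (x0 + r))
      (fun y hy => by rw [haz y hy, abs_zero])]
    calc ∫ y in Set.Ioo (x0 - r) (x0 + r), |a y| ∂(muBessel01 ν)
        ≤ ∫ y in Set.Ioo (x0 - r) (x0 + r), m⁻¹ ∂(muBessel01 ν) :=
          setIntegral_mono_on haint.abs.integrableOn (integrable_const _) measurableSet_Ioo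
            (fun y _ => hab y)
      _ = 1 := by
          rw [setIntegral_const, measureReal_def, ← hm, smul_eq_mul, mul_inv_cancel₀ hm0.ne']
  have hPa : ∀ x ∈ Set.Ioo (0:ℝ) 1, ∀ t : ℝ, 0 < t →
      Integrable (fun y => P t x y * a y) (muBessel01 ν) := by
    intro x hx t ht
    exact (hint x hx t ht).mul_bdd (c := m⁻¹) ham.aestronglyMeasurable (Filter.Eventually.of_forall hab)
  -- near bound
  have hnear : ∀ x ∈ Set.Ioo (0:ℝ) 1, ∀ t : ℝ, 0 < t →
      |∫ y, P t x y * a y ∂(muBessel01 ν)| ≤ A * (B / (2*r)) := by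
    intro x hx t ht
    calc |∫ y, P t x y * a y ∂(muBessel01 ν)| ≤ ∫ y, |P t x y * a y| ∂(muBessel01 ν) :=
          abs_integral_le_integral_abs
      _ ≤ ∫ y, |P t x y| * (B / (2*r)) ∂(muBessel01 ν) := by
          apply integral_mono (hPa x hx t ht).abs ((hint x hx t ht).abs.mul_const _)
          intro y
          simp only [abs_mul]
          exact mul_le_mul_of_nonneg_left ((hab y).trans hminv) (abs_nonneg _)
      _ = (∫ y, |P t x y| ∂(muBessel01 ν)) * (B / (2*r)) := integral_mul_const _ _
      _ ≤ _ := mul_le_mul_of_nonneg_right (hK1 x hx t ht) (by positivity)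
  have hq : |-(ν+1/2)| ≤ |2*ν+1| := by
    rw [abs_neg, show 2*ν+1 = 2*(ν+1/2) by ring, abs_mul, abs_two]
    linarith [abs_nonneg (ν+1/2)]
  have hq' : |ν+1/2| ≤ |2*ν+1| := by rwa [abs_neg] at hq
  -- far bound
  have hfar : ∀ x ∈ Set.Ioo (0:ℝ) 1, 2 * r ≤ |x - x0| → ∀ t : ℝ, 0 < t →
      |∫ y, P t x y * a y ∂(muBessel01 ν)| ≤
        A * B * x ^ (-(ν+1/2)) * (4 * c / (x - x0)^2) * r := by
    intro x hx hxr t ht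
    have hxq := Real.rpow_nonneg hx.1.le (-(ν+1/2))
    have hu : 0 < (x - x0)^2 := by
      rw [← sq_abs]
      have : 0 < |x - x0| := by linarith
      positivity
    set D : ℝ := A * B * x ^ (-(ν+1/2)) * (4 * c / (x - x0)^2) with hD
    have hD0 : 0 ≤ D := by positivity
    have hder' : ∀ z ∈ Set.Ioo (x0 - r) (x0 + r), ‖Py t x z‖ ≤ D := by
      intro z hz
      have hz01 := hIsub hz
      rw [Real.norm_eq_abs]
      refine (hK2 x hx z hz01 t ht).trans ?_
      rw [Real.mul_rpow hx.1.le hz01.1.le]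
      have hzq := bes_pow_le (-(ν+1/2)) (2*ν+1) z hq (by linarith [hz.1]) hz01.2.le
      have hzx : (x - x0)^2 / 4 ≤ (x - z)^2 := by
        have h1 : |z - x0| ≤ r := by
          rw [abs_le]; constructor <;> linarith [hz.1, hz.2]
        have h2 : |x - x0| ≤ |x - z| + |z - x0| := abs_sub_le _ _ _
        have h3 : |x - x0| / 2 ≤ |x - z| := by linarith
        have h4 := pow_le_pow_left₀ (by positivity) h3 2
        rw [div_pow, sq_abs, sq_abs] at h4
        linarith
      have hexp : t⁻¹ * Real.exp (-(x-z)^2 / (c*t)) ≤ 4 * c / (x - x0)^2 := by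
        have h5 := bes_exp ((x - x0)^2 / (4*c)) (by positivity) t ht
        rw [inv_div] at h5
        refine le_trans ?_ h5
        apply mul_le_mul_of_nonneg_left _ (by positivity)
        rw [Real.exp_le_exp, neg_div, neg_le_neg_iff, div_div, show 4*c*t = 4*(c*t) by ring,
          ← div_div]
        gcongr
      calc A * (x ^ (-(ν+1/2)) * z ^ (-(ν+1/2))) * t⁻¹ * Real.exp (-(x-z)^2 / (c*t))
          = A * (x ^ (-(ν+1/2)) * z ^ (-(ν+1/2))) * (t⁻¹ * Real.exp (-(x-z)^2 / (c*t))) := by ring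
        _ ≤ A * (x ^ (-(ν+1/2)) * B) * (4 * c / (x - x0)^2) := by gcongr
        _ = D := by rw [hD]; ring
    have hx0mem : x0 ∈ Set.Ioo (x0 - r) (x0 + r) := ⟨by linarith, by linarith⟩
    have hdiff : ∀ y ∈ Set.Ioo (x0 - r) (x0 + r), |P t x y - P t x x0| ≤ D * r := by
      intro y hy
      have := Convex.norm_image_sub_le_of_norm_hasDerivWithin_le (f := P t x) (f' := Py t x)
        (fun z hz => (hder t ht x hx z (hIsub hz)).hasDerivWithinAt) hder' (convex_Ioo _ _)
        hx0mem hy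
      rw [Real.norm_eq_abs, Real.norm_eq_abs] at this
      refine this.trans (mul_le_mul_of_nonneg_left ?_ hD0)
      rw [abs_le]; constructor <;> linarith [hy.1, hy.2]
    have heq : ∫ y, P t x y * a y ∂(muBessel01 ν)
        = ∫ y, (P t x y * a y - P t x x0 * a y) ∂(muBessel01 ν) := by
      rw [integral_sub (hPa x hx t ht) (haint.const_mul _), integral_const_mul, ha0']
      simp
    rw [heq]
    calc |∫ y, (P t x y * a y - P t x x0 * a y) ∂(muBessel01 ν)|
        ≤ ∫ y, |P t x y * a y - P t x x0 * a y| ∂(muBessel01 ν) := abs_integral_le_integral_abs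
      _ ≤ ∫ y, D * r * |a y| ∂(muBessel01 ν) := by
          apply integral_mono ((hPa x hx t ht).sub (haint.const_mul _)).abs (haint.abs.const_mul _)
          intro y
          change |P t x y * a y - P t x x0 * a y| ≤ D * r * |a y|
          rw [← sub_mul, abs_mul]
          by_cases hy : y ∈ Set.Ioo (x0 - r) (x0 + r)
          · exact mul_le_mul_of_nonneg_right (hdiff y hy) (abs_nonneg _)
          · simp [haz y hy]
      _ = D * r * ∫ y, |a y| ∂(muBessel01 ν) := integral_const_mul _ _
      _ ≤ D * r * 1 := mul_le_mul_of_nonneg_left haL1 (by positivity)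
      _ = D * r := mul_one _
  -- the dominating function
  obtain ⟨hp1, hp2⟩ := bes_poisson x0 r hr
  set h : ℝ → ℝ := fun x => K * (r / ((x - x0)^2 + r^2)) + K3 * x ^ (ν+1/2) with hh
  set g : ℝ → ℝ := fun x => x ^ (-(2*ν+1)) * h x with hg
  have hcongr : Set.EqOn (fun x => x ^ (2*ν+1) * g x) h (Set.Ioo 0 1) := by
    intro x hx
    simp only [hg]
    rw [← mul_assoc, ← Real.rpow_add hx.1]
    simp
  have hi1 : IntegrableOn (fun x => K * (r / ((x - x0)^2 + r^2))) (Set.Ioo 0 1) :=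
    (hp1.const_mul K).integrableOn
  have hi2 : IntegrableOn (fun x : ℝ => K3 * x ^ (ν+1/2)) (Set.Ioo 0 1) :=
    (bes_rpow (ν+1/2) (by linarith)).const_mul K3
  have hgint : Integrable g (muBessel01 ν) := by
    rw [bes_integrable]
    exact IntegrableOn.congr_fun (hi1.add hi2) hcongr.symm measurableSet_Ioo
  have hgval : ∫ x, g x ∂(muBessel01 ν) ≤
      K * Real.pi + K3 * ∫ x in Set.Ioo (0:ℝ) 1, x ^ (ν+1/2) := by
    rw [bes_integral, setIntegral_congr_fun measurableSet_Ioo hcongr]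
    simp only [hh]
    rw [integral_add hi1 hi2, integral_const_mul, integral_const_mul]
    gcongr
    rw [← hp2]
    exact setIntegral_le_integral hp1 (Filter.Eventually.of_forall (fun x => by positivity))
  refine le_trans (integral_mono_of_nonneg ?_ hgint ?_) hgval
  · exact Filter.Eventually.of_forall (fun x =>
      Real.iSup_nonneg (fun t => Real.iSup_nonneg (fun _ => abs_nonneg _)))
  · filter_upwards [bes_ae ν] with x hx
    have hxpos := hx.1
    have hxs : 0 < x ^ (2*ν+1) := Real.rpow_pos_of_pos hxpos _
    have hxq0 : 0 < x ^ (ν+1/2) := Real.rpow_pos_of_pos hxpos _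
    have hu2 : 0 < (x - x0)^2 + r^2 := by positivity
    have key : ∀ F : ℝ, x ^ (2*ν+1) * F ≤ h x → F ≤ g x := by
      intro F hF
      simp only [hg]
      rw [Real.rpow_neg hxpos.le, ← div_eq_inv_mul, le_div_iff₀ hxs]
      linarith
    have hh0 : 0 ≤ h x := by simp only [hh]; positivity
    have hg0 : 0 ≤ g x := key 0 (by simpa using hh0)
    refine Real.iSup_le (fun t => Real.iSup_le (fun ht => ?_) hg0) hg0
    by_cases hxr : 2 * r ≤ |x - x0|
    · refine (hfar x hx hxr t ht).trans (key _ ?_)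
      have hmul : x ^ (2*ν+1) * x ^ (-(ν+1/2)) = x ^ (ν+1/2) := by
        rw [← Real.rpow_add hxpos]; congr 1; ring
      have hsq : 4 * r^2 ≤ (x - x0)^2 := by
        have := pow_le_pow_left₀ (by positivity) hxr 2
        rw [sq_abs] at this
        linarith
      have hu : 0 < (x - x0)^2 := lt_of_lt_of_le (by positivity) hsq
      have e1 : x ^ (2*ν+1) * (A * B * x ^ (-(ν+1/2)) * (4 * c / (x - x0)^2) * r)
          = 4 * A * B * c * x ^ (ν+1/2) * (r / (x - x0)^2) := by
        rw [← hmul]; ring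
      rw [e1]
      simp only [hh]
      by_cases hx4 : 1/4 ≤ x
      · have hb := bes_pow_le (ν+1/2) (2*ν+1) x hq' hx4 hx.2.le
        have e2 : r / (x - x0)^2 ≤ 5/4 * (r / ((x - x0)^2 + r^2)) := by
          rw [← mul_div_assoc, div_le_div_iff₀ hu hu2]
          nlinarith only [mul_le_mul_of_nonneg_left hsq hr.le]
        calc 4 * A * B * c * x ^ (ν+1/2) * (r / (x - x0)^2)
            ≤ 4 * A * B * c * B * (5/4 * (r / ((x - x0)^2 + r^2))) := by gcongr
          _ = 5 * A * B^2 * c * (r / ((x - x0)^2 + r^2)) := by ring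
          _ ≤ K * (r / ((x - x0)^2 + r^2)) := by
              rw [hKdef]; gcongr; linarith
          _ ≤ _ := by linarith [mul_pos hK3 hxq0]
      · push Not at hx4
        have e2 : r / (x - x0)^2 ≤ 16 := by
          rw [div_le_iff₀ hu]
          have h7 : 1/4 ≤ x0 - x := by linarith
          nlinarith only [h7, hr1]
        calc 4 * A * B * c * x ^ (ν+1/2) * (r / (x - x0)^2)
            ≤ 4 * A * B * c * x ^ (ν+1/2) * 16 := by gcongr
          _ = K3 * x ^ (ν+1/2) := by rw [hK3def]; ring
          _ ≤ _ := by
            have : 0 ≤ K * (r / ((x - x0)^2 + r^2)) := by positivity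
            linarith
    · refine (hnear x hx t ht).trans (key _ ?_)
      push Not at hxr
      have hxr' := abs_lt.1 hxr
      have hb := bes_pow_le (2*ν+1) (2*ν+1) x le_rfl (by linarith [hxr'.1]) hx.2.le
      have hsq : (x - x0)^2 ≤ 4 * r^2 := by
        have := pow_le_pow_left₀ (abs_nonneg _) hxr.le 2
        rw [sq_abs] at this
        linarith
      have e2 : 1 / (2 * r) ≤ 5/2 * (r / ((x - x0)^2 + r^2)) := by
        rw [← mul_div_assoc, div_le_div_iff₀ (by positivity) hu2]
        nlinarith only [hsq]
      simp only [hh]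
      calc x ^ (2*ν+1) * (A * (B / (2*r))) = x ^ (2*ν+1) * (A * B) * (1 / (2*r)) := by ring
        _ ≤ B * (A * B) * (5/2 * (r / ((x - x0)^2 + r^2))) := by gcongr
        _ = 5/2 * A * B^2 * 1 * (r / ((x - x0)^2 + r^2)) := by ring
        _ ≤ 5 * A * B^2 * (1 + c) * (r / ((x - x0)^2 + r^2)) := by
            gcongr
            · norm_num
            · linarith
        _ ≤ _ := by linarith [mul_pos hK3 hxq0]
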